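/- Let ξ₀ > 0, T > 0, a > 0, and let ψ : ℝ × ℝ → ℝ be continuous on [0, ξ₀] × [0, T] such that at every point of (0, ξ₀) × (0, T] the partial derivatives ∂ₜψ and ∂ₓ²ψ exist and ∂ₜψ − ∂ₓ²ψ ≥ 0. Assume ψ(0, t) = 0 and ψ(ξ₀, t) ≥ 0 for all t ∈ [0, T], and ψ(x, 0) ≥ a·sin(π·x/ξ₀) for all x ∈ [0, ξ₀]. Then for every t ∈ [0, T] at which the one-sided space derivative ∂ₓψ(0, t) (the derivative from the right of x ↦ ψ(x, t) at x = 0) exists, one has ∂ₓψ(0, t) ≥ a·e^{−π²T/ξ₀²}·π/ξ₀ > 0. -/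

import Mathlib

open Real Set MeasureTheory intervalIntegral

/-- Partial derivative in the first (space) variable. -/
noncomputable def pdx (f : ℝ × ℝ → ℝ) (p : ℝ × ℝ) : ℝ :=
  deriv (fun x => f (x, p.2)) p.1

/-- Partial derivative in the second (time) variable. -/
noncomputable def pdt (f : ℝ × ℝ → ℝ) (p : ℝ × ℝ) : ℝ :=
  deriv (fun t => f (p.1, t)) p.2

/-- Second partial derivative in the first (space) variable. -/
noncomputable def pdxx (f : ℝ × ℝ → ℝ) (p : ℝ × ℝ) : ℝ :=
  deriv (fun x => pdx f (x, p.2)) p.1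

lemma aux_right (h : ℝ → ℝ) (d x b : ℝ) (hb : x < b) (hd : HasDerivWithinAt h d (Set.Ici x) x)
    (hm : ∀ y ∈ Set.Ioo x b, h x ≤ h y) : 0 ≤ d := by
  have h1 := (hd.mono Set.Ioi_subset_Ici_self)
  rw [hasDerivWithinAt_iff_tendsto_slope' (by simp)] at h1
  refine ge_of_tendsto h1 ?_
  filter_upwards [Ioo_mem_nhdsGT hb] with y hy
  rw [slope_def_field]
  exact div_nonneg (by linarith [hm y hy]) (by linarith [hy.1])

lemma aux_left (h : ℝ → ℝ) (d x b : ℝ) (hb : b < x) (hd : HasDerivAt h d x)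
    (hm : ∀ y ∈ Set.Ioo b x, h x ≤ h y) : d ≤ 0 := by
  have h1 := (hd.hasDerivWithinAt (s := Set.Iio x))
  rw [hasDerivWithinAt_iff_tendsto_slope' (by simp)] at h1
  refine le_of_tendsto h1 ?_
  filter_upwards [Ioo_mem_nhdsLT hb] with y hy
  rw [slope_def_field]
  exact div_nonpos_of_nonneg_of_nonpos (by linarith [hm y hy]) (by linarith [hy.2])

lemma aux_second (g : ℝ → ℝ) (x : ℝ) (hm : IsLocalMin g x) (hc : ContinuousAt g x) :
    0 ≤ deriv (deriv g) x := by
  by_contra hneg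
  push Not at hneg
  have hM := isLocalMax_of_deriv_deriv_neg hneg hm.deriv_eq_zero hc
  have he : g =ᶠ[nhds x] fun _ => g x := by
    filter_upwards [hm, hM] with y h1 h2
    exact le_antisymm h2 h1
  have h2 : deriv g =ᶠ[nhds x] deriv (fun _ => g x) := he.deriv
  rw [h2.deriv_eq] at hneg
  simp at hneg

lemma aux_compare (ξ₀ T a : ℝ) (hξ : 0 < ξ₀) (hT : 0 < T) (ha : 0 < a)
    (ψ : ℝ × ℝ → ℝ)
    (hcont : ContinuousOn ψ (Set.Icc 0 ξ₀ ×ˢ Set.Icc 0 T))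
    (hψt : ∀ p ∈ Set.Ioo 0 ξ₀ ×ˢ Set.Ioc 0 T, DifferentiableAt ℝ (fun t => ψ (p.1, t)) p.2)
    (hψx : ∀ p ∈ Set.Ioo 0 ξ₀ ×ˢ Set.Ioc 0 T, DifferentiableAt ℝ (fun x => ψ (x, p.2)) p.1)
    (hψxx : ∀ p ∈ Set.Ioo 0 ξ₀ ×ˢ Set.Ioc 0 T, DifferentiableAt ℝ (fun x => pdx ψ (x, p.2)) p.1)
    (hsuper : ∀ p ∈ Set.Ioo 0 ξ₀ ×ˢ Set.Ioc 0 T, 0 ≤ pdt ψ p - pdxx ψ p)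
    (hb0 : ∀ t ∈ Set.Icc 0 T, ψ (0, t) = 0)
    (hbl : ∀ t ∈ Set.Icc 0 T, 0 ≤ ψ (ξ₀, t))
    (hinit : ∀ x ∈ Set.Icc 0 ξ₀, a * Real.sin (π * x / ξ₀) ≤ ψ (x, 0))
    (ε : ℝ) (hε : 0 < ε) (p : ℝ × ℝ) (hp : p ∈ Set.Icc 0 ξ₀ ×ˢ Set.Icc 0 T) :
    0 ≤ ψ p - a * Real.exp (-(π / ξ₀) ^ 2 * p.2) * Real.sin (π / ξ₀ * p.1) + ε * p.2 := by
  set k := π / ξ₀ with hk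
  have hkξ : k * ξ₀ = π := by rw [hk]; field_simp
  set F : ℝ × ℝ → ℝ :=
    fun p => ψ p - a * Real.exp (-k ^ 2 * p.2) * Real.sin (k * p.1) + ε * p.2 with hF
  have hFc : ContinuousOn F (Set.Icc 0 ξ₀ ×ˢ Set.Icc 0 T) := by
    refine (hcont.sub ?_).add ?_ <;> fun_prop
  obtain ⟨⟨x, t⟩, hq, hmin⟩ := (isCompact_Icc.prod isCompact_Icc).exists_isMinOn ⟨p, hp⟩ hFc
  have hmin' : ∀ y ∈ Set.Icc 0 ξ₀ ×ˢ Set.Icc 0 T, F (x, t) ≤ F y := fun y hy => hmin hy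
  refine le_trans ?_ (hmin' p hp)
  obtain ⟨⟨hx0, hx1⟩, ht0, ht1⟩ := hq
  simp only at hx0 hx1 ht0 ht1
  rcases hx0.eq_or_lt with h | hx0
  · subst h
    simp only [hF, hb0 t ⟨ht0, ht1⟩]
    simp; positivity
  rcases hx1.eq_or_lt with h | hx1
  · subst h
    have := hbl t ⟨ht0, ht1⟩
    simp only [hF, hkξ]
    simp; positivity
  rcases ht0.eq_or_lt with h | ht0
  · subst h
    have := hinit x ⟨hx0.le, hx1.le⟩
    have e : k * x = π * x / ξ₀ := by rw [hk]; ring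
    simp only [hF, e]
    simpa using this
  exfalso
  have hP : (x, t) ∈ Set.Ioo 0 ξ₀ ×ˢ Set.Ioc 0 T := ⟨⟨hx0, hx1⟩, ht0, ht1⟩
  have hs := hsuper _ hP
  have h1 : HasDerivAt (fun s => F (x, s))
      (pdt ψ (x, t) - a * (Real.exp (-k ^ 2 * t) * (-k ^ 2)) * Real.sin (k * x) + ε) t := by
    have e1 : HasDerivAt (fun s => ψ (x, s)) (pdt ψ (x, t)) t := (hψt _ hP).hasDerivAt
    have e2 : HasDerivAt (fun s : ℝ => -k ^ 2 * s) (-k ^ 2) t := by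
      simpa using (hasDerivAt_id t).const_mul (-k ^ 2)
    have e3 : HasDerivAt (fun s : ℝ => ε * s) ε t := by
      simpa using (hasDerivAt_id t).const_mul ε
    exact (e1.sub ((e2.exp.const_mul a).mul_const (Real.sin (k * x)))).add e3
  have h2 := aux_left _ _ t 0 ht0 h1 (fun s hs' => hmin' (x, s)
    ⟨⟨hx0.le, hx1.le⟩, hs'.1.le, hs'.2.le.trans ht1⟩)
  set A := a * Real.exp (-k ^ 2 * t) with hA
  have hlin : ∀ y : ℝ, HasDerivAt (fun y : ℝ => k * y) k y := fun y => by
    simpa using (hasDerivAt_id y).const_mul k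
  have h3 : ∀ y ∈ Set.Ioo 0 ξ₀, HasDerivAt (fun y => F (y, t))
      (pdx ψ (y, t) - A * (Real.cos (k * y) * k)) y := by
    intro y hy
    have e1 : HasDerivAt (fun s => ψ (s, t)) (pdx ψ (y, t)) y :=
      (hψx (y, t) ⟨hy, ht0, ht1⟩).hasDerivAt
    exact (e1.sub ((hlin y).sin.const_mul A)).add_const (ε * t)
  have h4 : deriv (fun y => F (y, t)) =ᶠ[nhds x]
      fun y => pdx ψ (y, t) - A * (Real.cos (k * y) * k) := by
    filter_upwards [Ioo_mem_nhds hx0 hx1] with y hy using (h3 y hy).deriv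
  have h5 : HasDerivAt (fun y => pdx ψ (y, t) - A * (Real.cos (k * y) * k))
      (pdxx ψ (x, t) - A * (-Real.sin (k * x) * k * k)) x := by
    have e1 : HasDerivAt (fun s => pdx ψ (s, t)) (pdxx ψ (x, t)) x := (hψxx _ hP).hasDerivAt
    exact e1.sub (((hlin x).cos.mul_const k).const_mul A)
  have h6 := aux_second (fun y => F (y, t)) x (by
    filter_upwards [Ioo_mem_nhds hx0 hx1] with y hy
    exact hmin' (y, t) ⟨⟨hy.1.le, hy.2.le⟩, ht0.le, ht1⟩) (h3 x ⟨hx0, hx1⟩).continuousAt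
  rw [h4.deriv_eq, h5.deriv] at h6
  have e : a * (Real.exp (-k ^ 2 * t) * (-k ^ 2)) * Real.sin (k * x)
      = A * (-Real.sin (k * x) * k * k) := by rw [hA]; ring
  rw [e] at h2
  linarith

/-- uniform-in-time positive lower bound on the boundary flux
`∂ₓψ(0, ·)` of a supersolution of the heat equation dominating
`a sin (π x / ξ₀)` at time `0` and vanishing at `x = 0`. -/
theorem stmt_8 (ξ₀ T a : ℝ) (hξ : 0 < ξ₀) (hT : 0 < T) (ha : 0 < a)
    (ψ : ℝ × ℝ → ℝ)
    (hcont : ContinuousOn ψ (Set.Icc 0 ξ₀ ×ˢ Set.Icc 0 T))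
    (hψt : ∀ p ∈ Set.Ioo 0 ξ₀ ×ˢ Set.Ioc 0 T, DifferentiableAt ℝ (fun t => ψ (p.1, t)) p.2)
    (hψx : ∀ p ∈ Set.Ioo 0 ξ₀ ×ˢ Set.Ioc 0 T, DifferentiableAt ℝ (fun x => ψ (x, p.2)) p.1)
    (hψxx : ∀ p ∈ Set.Ioo 0 ξ₀ ×ˢ Set.Ioc 0 T, DifferentiableAt ℝ (fun x => pdx ψ (x, p.2)) p.1)
    (hsuper : ∀ p ∈ Set.Ioo 0 ξ₀ ×ˢ Set.Ioc 0 T, 0 ≤ pdt ψ p - pdxx ψ p)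
    (hb0 : ∀ t ∈ Set.Icc 0 T, ψ (0, t) = 0)
    (hbl : ∀ t ∈ Set.Icc 0 T, 0 ≤ ψ (ξ₀, t))
    (hinit : ∀ x ∈ Set.Icc 0 ξ₀, a * Real.sin (π * x / ξ₀) ≤ ψ (x, 0)) :
    0 < a * Real.exp (-(π ^ 2) * T / ξ₀ ^ 2) * π / ξ₀ ∧
    ∀ t ∈ Set.Icc 0 T, ∀ d : ℝ,
      HasDerivWithinAt (fun x => ψ (x, t)) d (Set.Ici 0) 0 →
        a * Real.exp (-(π ^ 2) * T / ξ₀ ^ 2) * π / ξ₀ ≤ d := by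
  refine ⟨by positivity, fun t ht d hd => ?_⟩
  have hcmp : ∀ x ∈ Set.Icc 0 ξ₀,
      0 ≤ ψ (x, t) - a * Real.exp (-(π / ξ₀) ^ 2 * t) * Real.sin (π / ξ₀ * x) := by
    intro x hx
    refine le_of_forall_pos_le_add fun δ hδ => ?_
    have := aux_compare ξ₀ T a hξ hT ha ψ hcont hψt hψx hψxx hsuper hb0 hbl hinit
      (δ / T) (by positivity) (x, t) ⟨hx, ht⟩
    have h2 : δ / T * t ≤ δ := by
      rw [div_mul_eq_mul_div, div_le_iff₀ hT]
      exact mul_le_mul_of_nonneg_left ht.2 hδ.le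
    simp only at this
    linarith
  have hlin : HasDerivAt (fun y : ℝ => π / ξ₀ * y) (π / ξ₀) 0 := by
    simpa using (hasDerivAt_id (0 : ℝ)).const_mul (π / ξ₀)
  have hD := hd.sub ((hlin.sin.const_mul
    (a * Real.exp (-(π / ξ₀) ^ 2 * t))).hasDerivWithinAt (s := Set.Ici 0))
  have h0 := aux_right _ _ 0 ξ₀ hξ hD (fun y hy => by
    have := hcmp y ⟨hy.1.le, hy.2.le⟩
    simpa [hb0 t ht] using this)
  simp only [mul_zero, Real.cos_zero, one_mul] at h0
  have hexp : Real.exp (-(π ^ 2) * T / ξ₀ ^ 2) ≤ Real.exp (-(π / ξ₀) ^ 2 * t) := by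
    apply Real.exp_le_exp.mpr
    have e : -(π ^ 2) * T / ξ₀ ^ 2 = -(π / ξ₀) ^ 2 * T := by field_simp
    rw [e]
    nlinarith [mul_le_mul_of_nonneg_left ht.2 (sq_nonneg (π / ξ₀))]
  calc a * Real.exp (-(π ^ 2) * T / ξ₀ ^ 2) * π / ξ₀
      = a * Real.exp (-(π ^ 2) * T / ξ₀ ^ 2) * (π / ξ₀) := by ring
    _ ≤ a * Real.exp (-(π / ξ₀) ^ 2 * t) * (π / ξ₀) := by gcongr
    _ ≤ d := by linarith
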